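/- Let A ∈ ℤ^{d×n} be a unimodular matrix of rank d with columns a_1,…,a_n, let i_1,…,i_d ∈ {1,…,n} be indices and ε_1,…,ε_d ∈ {1,−1} signs, and let M ∈ ℤ^{(d+1)×(d+1)} be the matrix with columns (0,…,0,1)ᵀ and (ε_1 a_{i_1},1)ᵀ, …, (ε_d a_{i_d},1)ᵀ. If det M ≠ 0, then |det M| = δ(A), and consequently the columns of M generate the same subgroup of ℤ^{d+1} as the columns of A^±, i.e. ℤM = ℤA^±. -/

import Mathlib

/-- The subgroup `ℤM` of `ℤ^D` generated by the columns of an integer matrix. -/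
def colLattice {D m : ℕ} (M : Matrix (Fin D) (Fin m) ℤ) : AddSubgroup (Fin D → ℤ) :=
  AddSubgroup.closure (Set.range fun j i => M i j)

/-- The centrally symmetric configuration `A^± ∈ ℤ^{(d+1)×(2n+1)}` of `A ∈ ℤ^{d×n}`:
its columns are `(0,…,0,1)ᵀ` (column `0`), `(a_j, 1)ᵀ` (columns `1,…,n`) and
`(−a_j, 1)ᵀ` (columns `n+1,…,2n`). -/
def csc {d n : ℕ} (A : Matrix (Fin d) (Fin n) ℤ) :
    Matrix (Fin (d + 1)) (Fin (2 * n + 1)) ℤ := fun i j =>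
  if hi : (i : ℕ) < d then
    if h0 : (j : ℕ) = 0 then 0
    else if hj : (j : ℕ) ≤ n then A ⟨i, hi⟩ ⟨(j : ℕ) - 1, by omega⟩
    else - A ⟨i, hi⟩ ⟨(j : ℕ) - n - 1, by have := j.isLt; omega⟩
  else 1

theorem mulVec_mem_colLattice {D m : ℕ} (M : Matrix (Fin D) (Fin m) ℤ) (c : Fin m → ℤ) :
    M.mulVec c ∈ colLattice M := by
  have h : M.mulVec c = ∑ j, c j • fun i => M i j := by
    ext i
    simp [Matrix.mulVec, dotProduct, Finset.sum_apply, mul_comm]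
  rw [h]
  exact sum_mem fun j _ => zsmul_mem (AddSubgroup.subset_closure (Set.mem_range_self j)) _

/-- In a unimodular matrix, every column is an integer combination of the columns of any
nonsingular maximal square submatrix. -/
theorem exists_mulVec_submatrix_eq_col {d n : ℕ} {A : Matrix (Fin d) (Fin n) ℤ} {δ : ℕ}
    (hδ : ∀ σ : Fin d → Fin n,
      (A.submatrix id σ).det ≠ 0 → (A.submatrix id σ).det.natAbs = δ)
    {σ : Fin d → Fin n} (hσ : (A.submatrix id σ).det ≠ 0) (j : Fin n) :
    ∃ c : Fin d → ℤ, (A.submatrix id σ).mulVec c = fun i => A i j := by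
  set B := A.submatrix id σ with hB
  have key : ∀ k, B.det ∣ B.cramer (fun i => A i j) k := by
    intro k
    have h : B.updateCol k (fun i => A i j) = A.submatrix id (Function.update σ k j) := by
      ext i l
      by_cases hl : l = k
      · subst hl
        simp
      · simp [hB, hl]
    rw [Matrix.cramer_apply, h]
    by_cases h0 : (A.submatrix id (Function.update σ k j)).det = 0
    · simp [h0]
    · rw [← Int.natAbs_dvd_natAbs, hδ _ h0, hδ _ hσ]
  choose c hc using key
  refine ⟨c, ?_⟩
  have h := Matrix.mulVec_cramer B (fun i => A i j)
  rw [show B.cramer (fun i => A i j) = B.det • c from funext hc, Matrix.mulVec_smul] at h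
  exact smul_right_injective _ hσ h


/-- **Key step in Theorem 2.6.**  Let `A ∈ ℤ^{d×n}` be a unimodular matrix of rank `d`
(all nonzero maximal minors have the same absolute value `δ`, and some maximal minor
is nonzero).  Let `M ∈ ℤ^{(d+1)×(d+1)}` be the matrix with columns `(0,…,0,1)ᵀ` and
`(ε_k a_{i_k}, 1)ᵀ`, `k = 1,…,d`, where each `ε_k ∈ {1,−1}`.  If `det M ≠ 0` then
`|det M| = δ(A)` and the columns of `M` generate the same subgroup of `ℤ^{d+1}` as
the columns of `A^±`. -/
theorem det_simplex_eq_delta_and_lattice_eq (d n : ℕ)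
    (A : Matrix (Fin d) (Fin n) ℤ) (hrank : A.rank = d) (δ : ℕ)
    (hδ : ∀ σ : Fin d → Fin n,
      (A.submatrix id σ).det ≠ 0 → (A.submatrix id σ).det.natAbs = δ)
    (hex : ∃ σ : Fin d → Fin n, (A.submatrix id σ).det ≠ 0)
    (idx : Fin d → Fin n) (ε : Fin d → ℤ) (hε : ∀ k, ε k = 1 ∨ ε k = -1)
    (M : Matrix (Fin (d + 1)) (Fin (d + 1)) ℤ)
    (hM : M = fun (i k : Fin (d + 1)) =>
      if hk : (k : ℕ) = 0 then (if (i : ℕ) < d then 0 else 1)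
      else if hi : (i : ℕ) < d then
        ε ⟨(k : ℕ) - 1, by have := k.isLt; omega⟩ *
          A ⟨i, hi⟩ (idx ⟨(k : ℕ) - 1, by have := k.isLt; omega⟩)
      else 1)
    (hdet : M.det ≠ 0) :
    M.det.natAbs = δ ∧ colLattice M = colLattice (csc A) := by
  set B := A.submatrix id idx with hB
  have hM0 : ∀ i : Fin d, M i.castSucc 0 = 0 := fun i => by simp [hM]
  have hM1 : ∀ k, M (Fin.last d) k = 1 := fun k => by simp [hM]
  have hM2 : ∀ (i k : Fin d), M i.castSucc k.succ = ε k * B i k := fun i k => by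
    simp [hM, hB]
  have hdetM : M.det = (-1) ^ d * (B.det * ∏ k, ε k) := by
    rw [Matrix.det_succ_column M 0, Fin.sum_univ_castSucc]
    have hs : M.submatrix (Fin.last d).succAbove (Fin.succAbove 0) = B * Matrix.diagonal ε := by
      ext i k
      simp [hM2, mul_comm]
    simp only [hM0, hM1, hs, Matrix.det_mul, Matrix.det_diagonal]
    simp
  have hε1 : (∏ k, ε k).natAbs = 1 := by
    rw [← Int.isUnit_iff_natAbs_eq]
    exact (IsUnit.prod_univ_iff).2 fun k => Int.isUnit_iff.2 (hε k)
  have hBdet : B.det ≠ 0 := fun h => hdet (by simp [hdetM, h])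
  refine ⟨by simp [hdetM, Int.natAbs_mul, Int.natAbs_pow, hε1, hB, hδ idx hBdet], ?_⟩
  have hmem : ∀ (x : Fin (d + 1) → ℤ) (c : Fin d → ℤ),
      (∀ i : Fin d, x i.castSucc = B.mulVec c i) → x ∈ colLattice M := by
    intro x c hx
    have h : x = M.mulVec (Fin.cons (x (Fin.last d) - ∑ k, ε k * c k) fun k => ε k * c k) := by
      ext i
      refine Fin.lastCases ?_ (fun i => ?_) i
      · simp [Matrix.mulVec, dotProduct, Fin.sum_univ_succ, hM1]
      · simp only [hx, Matrix.mulVec, dotProduct, Fin.sum_univ_succ, hM0, hM2, Fin.cons_zero,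
          Fin.cons_succ, zero_mul, zero_add]
        refine Finset.sum_congr rfl fun k _ => ?_
        rcases hε k with h | h <;> simp [h]
    rw [h]
    exact mulVec_mem_colLattice M _
  apply le_antisymm
  · refine (AddSubgroup.closure_le _).2 ?_
    rintro _ ⟨k, rfl⟩
    refine AddSubgroup.subset_closure ?_
    refine Fin.cases ⟨0, ?_⟩ (fun k => ?_) k
    · ext i
      refine Fin.lastCases ?_ (fun i => ?_) i
      · simp [csc, hM1]
      · simp [csc, hM0]
    · rcases hε k with h | h
      · refine ⟨⟨idx k + 1, by omega⟩, ?_⟩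
        ext i
        refine Fin.lastCases ?_ (fun i => ?_) i
        · simp [csc, hM1]
        · simp [csc, hM2, h, hB]
      · refine ⟨⟨n + idx k + 1, by omega⟩, ?_⟩
        ext i
        refine Fin.lastCases ?_ (fun i => ?_) i
        · simp [csc, hM1]
        · have h1 : ¬ n + (idx k : ℕ) + 1 ≤ n := by omega
          have h2 : n + (idx k : ℕ) + 1 - n - 1 = idx k := by omega
          simp [csc, hM2, h, hB, h1, h2]
  · refine (AddSubgroup.closure_le _).2 ?_
    rintro _ ⟨j, rfl⟩
    by_cases h0 : (j : ℕ) = 0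
    · exact hmem _ 0 fun i => by simp [csc, h0]
    by_cases hj : (j : ℕ) ≤ n
    · obtain ⟨c, hc⟩ := exists_mulVec_submatrix_eq_col hδ hBdet ⟨(j : ℕ) - 1, by omega⟩
      exact hmem _ c fun i => by simp [csc, h0, hj, hB, hc]
    · obtain ⟨c, hc⟩ := exists_mulVec_submatrix_eq_col hδ hBdet ⟨(j : ℕ) - n - 1, by omega⟩
      exact hmem _ (-c) fun i => by simp [csc, h0, hj, hB, hc, Matrix.mulVec_neg]
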